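/- Let A be an integer (r,s)×t bimatrix with 𝒢(A₂) nonempty, let p := |𝒢(A₂)|, and let G₂ be the t×p integer matrix whose columns are the elements of 𝒢(A₂). Then the Graver complexity g(A) of A equals the maximum of ‖v‖₁ over all elements v of the Graver basis 𝒢(A₁G₂) of the r×p matrix A₁G₂, where this maximum is taken to be 0 if 𝒢(A₁G₂) is empty. -/

import Mathlib

open Matrix

/-- The conformal (sign-compatible) partial order `x ⊑ y` on integer vectors:
`x k * y k ≥ 0` and `|x k| ≤ |y k|` for every coordinate `k`. -/
def ConformalLe {ν : Type*} (x y : ν → ℤ) : Prop :=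
  ∀ k, 0 ≤ x k * y k ∧ |x k| ≤ |y k|

/-- The Graver basis of an integer matrix `A`: the set of `⊑`-minimal elements of
`{x : A x = 0, x ≠ 0}`. -/
def GraverBasis {μ ν : Type*} [Fintype ν] (A : Matrix μ ν ℤ) : Set (ν → ℤ) :=
  {x | A.mulVec x = 0 ∧ x ≠ 0 ∧
    ∀ y, A.mulVec y = 0 → y ≠ 0 → ConformalLe y x → y = x}

/-- The `ι`-fold product of the bimatrix with blocks `A1` (first block, `r × τ`) and
`A2` (second block, `s × τ`): the first `r` rows are `(A1 A1 ⋯ A1)` and the remaining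
rows form a block-diagonal matrix with a copy of `A2` for each index in `ι`. -/
def nFold {r s : ℕ} {τ : Type*} (A1 : Matrix (Fin r) τ ℤ) (A2 : Matrix (Fin s) τ ℤ)
    (ι : Type*) [DecidableEq ι] : Matrix (Fin r ⊕ ι × Fin s) (ι × τ) ℤ :=
  Matrix.of fun i jt =>
    match i with
    | Sum.inl a => A1 a jt.2
    | Sum.inr (k, c) => if jt.1 = k then A2 c jt.2 else 0

/-- The `i`-th brick of a vector indexed by `ι × τ`. -/
def brick {ι τ : Type*} (x : ι × τ → ℤ) (i : ι) : τ → ℤ := fun j => x (i, j)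

/-- The Graver complexity of the bimatrix `(A1, A2)`: the largest number of nonzero
bricks appearing in any element of the Graver basis of any `n`-fold product. -/
noncomputable def graverComplexity {r s t : ℕ} (A1 : Matrix (Fin r) (Fin t) ℤ)
    (A2 : Matrix (Fin s) (Fin t) ℤ) : ℕ :=
  sSup {k : ℕ | ∃ (n : ℕ) (g : Fin n × Fin t → ℤ),
    g ∈ GraverBasis (nFold A1 A2 (Fin n)) ∧
    k = {i : Fin n | brick g i ≠ 0}.ncard}

/-- `Z(A)`: the set of all vectors in `ℤ^t` that are sums of at most `g(A)` elements
of the Graver basis of `A2`. -/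
noncomputable def ZSet {r s t : ℕ} (A1 : Matrix (Fin r) (Fin t) ℤ)
    (A2 : Matrix (Fin s) (Fin t) ℤ) : Set (Fin t → ℤ) :=
  {z | ∃ L : List (Fin t → ℤ), L.length ≤ graverComplexity A1 A2 ∧
    (∀ h ∈ L, h ∈ GraverBasis A2) ∧ z = L.sum}

theorem Int.mul_nonneg_and_abs_le_abs_iff {a b : ℤ} :
    (0 ≤ a * b ∧ |a| ≤ |b|) ↔ (0 ≤ a ∧ a ≤ b) ∨ (b ≤ a ∧ a ≤ 0) := by
  constructor
  · rintro ⟨h1, h2⟩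
    rcases mul_nonneg_iff.1 h1 with ⟨ha, hb⟩ | ⟨ha, hb⟩
    · rw [abs_of_nonneg ha, abs_of_nonneg hb] at h2
      exact Or.inl ⟨ha, h2⟩
    · rw [abs_of_nonpos ha, abs_of_nonpos hb] at h2
      exact Or.inr ⟨by omega, ha⟩
  · rintro (⟨h1, h2⟩ | ⟨h1, h2⟩)
    · exact ⟨mul_nonneg h1 (h1.trans h2), abs_le_abs_of_nonneg h1 h2⟩
    · exact ⟨mul_nonneg_of_nonpos_of_nonpos h2 (h1.trans h2), abs_le_abs_of_nonpos h2 h1⟩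

namespace ConformalLe

variable {ν : Type*} {x y z : ν → ℤ}

theorem iff_forall :
    ConformalLe x y ↔ ∀ k, (0 ≤ x k ∧ x k ≤ y k) ∨ (y k ≤ x k ∧ x k ≤ 0) :=
  forall_congr' fun _ => Int.mul_nonneg_and_abs_le_abs_iff

theorem refl (x : ν → ℤ) : ConformalLe x x :=
  iff_forall.2 fun k => by omega

theorem trans (hxy : ConformalLe x y) (hyz : ConformalLe y z) : ConformalLe x z := by
  rw [iff_forall] at *
  intro k
  have := hxy k
  have := hyz k
  omega

theorem sub_right (h : ConformalLe x y) : ConformalLe (y - x) y := by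
  rw [iff_forall] at *
  intro k
  have := h k
  simp only [Pi.sub_apply]
  omega

theorem neg (h : ConformalLe x y) : ConformalLe (-x) (-y) := by
  rw [iff_forall] at *
  intro k
  have := h k
  simp only [Pi.neg_apply]
  omega

/-- The order `⊑` strictly increases the `1`-norm. -/
theorem sum_natAbs_lt [Fintype ν] (h : ConformalLe x y) (hne : x ≠ y) :
    ∑ k, (x k).natAbs < ∑ k, (y k).natAbs := by
  rw [iff_forall] at h
  obtain ⟨k, hk⟩ := Function.ne_iff.1 hne
  refine Finset.sum_lt_sum (fun i _ => ?_) ⟨k, Finset.mem_univ _, ?_⟩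
  · have := h i
    omega
  · have := h k
    omega

end ConformalLe

section GraverBasis

variable {μ ν : Type*} [Fintype ν] {A : Matrix μ ν ℤ}

theorem neg_mem_graverBasis {g : ν → ℤ} (hg : g ∈ GraverBasis A) : -g ∈ GraverBasis A := by
  obtain ⟨h1, h2, h3⟩ := hg
  refine ⟨by rw [Matrix.mulVec_neg, h1, neg_zero], neg_ne_zero.2 h2, fun y hy hy0 hyg => ?_⟩
  rw [← h3 (-y) (by rw [Matrix.mulVec_neg, hy, neg_zero]) (neg_ne_zero.2 hy0)
    (by simpa using hyg.neg), neg_neg]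

theorem exists_mem_graverBasis_conformalLe {x : ν → ℤ} (hx : A.mulVec x = 0) (hx0 : x ≠ 0) :
    ∃ g ∈ GraverBasis A, ConformalLe g x := by
  induction hn : ∑ k, (x k).natAbs using Nat.strong_induction_on generalizing x with
  | _ n ih =>
    by_cases hxg : x ∈ GraverBasis A
    · exact ⟨x, hxg, .refl x⟩
    · obtain ⟨y, hy, hy0, hyx, hne⟩ : ∃ y, A.mulVec y = 0 ∧ y ≠ 0 ∧ ConformalLe y x ∧ y ≠ x := by
        by_contra! h
        exact hxg ⟨hx, hx0, h⟩
      obtain ⟨g, hg, hgy⟩ := ih _ (hn ▸ hyx.sum_natAbs_lt hne) hy hy0 rfl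
      exact ⟨g, hg, hgy.trans hyx⟩

theorem finite_graverBasis (A : Matrix μ ν ℤ) : (GraverBasis A).Finite := by
  let φ : (ν → ℤ) → ν → ℕ × ℕ := fun x k => ((x k).toNat, (-x k).toNat)
  have hle : ∀ x y, φ x ≤ φ y → ConformalLe x y := by
    intro x y h
    rw [ConformalLe.iff_forall]
    intro k
    have := (h k).1
    have := (h k).2
    simp only [φ] at *
    omega
  have hinj : Function.Injective φ := by
    intro x y h
    funext k
    have := congrFun h k
    simp only [φ, Prod.mk.injEq] at this
    omega
  refine Set.Finite.of_finite_image (f := φ) ?_ hinj.injOn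
  refine WellQuasiOrderedLE.finite_of_isAntichain ?_
  rintro _ ⟨x, hx, rfl⟩ _ ⟨y, hy, rfl⟩ hne h
  exact hne (congrArg φ (hy.2.2 x hx.1 hx.2.1 (hle x y h)))

/-- Every kernel vector is a conformal sum of Graver basis elements, listed as the columns of
`G`. -/
theorem exists_conformal_decomposition {π : Type*} [Fintype π] (G : Matrix ν π ℤ)
    (hG : GraverBasis A ⊆ Set.range G.col) {x : ν → ℤ} (hx : A.mulVec x = 0) :
    ∃ c : π → ℕ, G.mulVec (fun j => (c j : ℤ)) = x ∧ ∀ j, c j ≠ 0 → ConformalLe (G.col j) x := by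
  classical
  induction hn : ∑ k, (x k).natAbs using Nat.strong_induction_on generalizing x with
  | _ n ih =>
    by_cases hx0 : x = 0
    · exact ⟨0, by subst hx0; funext i; simp [Matrix.mulVec, dotProduct], by simp⟩
    obtain ⟨g, hg, hgx⟩ := exists_mem_graverBasis_conformalLe hx hx0
    obtain ⟨i, rfl⟩ := hG hg
    have hsub := hgx.sub_right
    obtain ⟨c, hc, hcx⟩ := ih _
      (hn ▸ hsub.sum_natAbs_lt fun h => hg.2.1 (by simpa using h))
      (by rw [Matrix.mulVec_sub, hx, hg.1, sub_zero]) rfl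
    refine ⟨c + Pi.single i 1, ?_, fun j hj => ?_⟩
    · have : (fun j => (((c + Pi.single i 1 : π → ℕ) j : ℕ) : ℤ))
          = (fun j => (c j : ℤ)) + Pi.single i 1 := by
        funext j
        by_cases h : j = i
        · subst h; simp
        · simp [h]
      rw [this, Matrix.mulVec_add, hc, Matrix.mulVec_single_one, sub_add_cancel]
    · by_cases h : j = i
      · exact h ▸ hgx
      · exact (hcx j (by simpa [h] using hj)).trans hsub

end GraverBasis

theorem nFold_mulVec_eq_zero_iff {r s : ℕ} {ι τ : Type*} [Fintype ι] [DecidableEq ι] [Fintype τ]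
    {A1 : Matrix (Fin r) τ ℤ} {A2 : Matrix (Fin s) τ ℤ} {x : ι × τ → ℤ} :
    (nFold A1 A2 ι).mulVec x = 0 ↔
      A1.mulVec (∑ i, brick x i) = 0 ∧ ∀ i, A2.mulVec (brick x i) = 0 := by
  have h1 : ∀ a, (nFold A1 A2 ι).mulVec x (Sum.inl a) = A1.mulVec (∑ i, brick x i) a := by
    intro a
    simp [Matrix.mulVec, dotProduct, nFold, brick, Fintype.sum_prod_type, Finset.mul_sum]
    exact Finset.sum_comm
  have h2 : ∀ i c, (nFold A1 A2 ι).mulVec x (Sum.inr (i, c)) = A2.mulVec (brick x i) c := by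
    intro i c
    simp [Matrix.mulVec, dotProduct, nFold, brick, Fintype.sum_prod_type, ite_mul,
      Finset.sum_ite_irrel]
  constructor
  · intro h
    exact ⟨funext fun a => by rw [← h1, h]; rfl, fun i => funext fun c => by rw [← h2, h]; rfl⟩
  · rintro ⟨h, h'⟩
    funext a
    rcases a with a | ⟨i, c⟩
    · rw [h1, h]; rfl
    · rw [h2, h']; rfl

theorem Finset.exists_le_sum_eq {ι : Type*} [DecidableEq ι] (s : Finset ι) (f : ι → ℕ) {w : ℕ}
    (hw : w ≤ ∑ i ∈ s, f i) : ∃ d : ι → ℕ, (∀ i, d i ≤ f i) ∧ ∑ i ∈ s, d i = w := by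
  induction s using Finset.induction_on generalizing w with
  | empty => exact ⟨0, fun i => Nat.zero_le _, by simpa [eq_comm] using hw⟩
  | insert a s ha ih =>
    rw [Finset.sum_insert ha] at hw
    obtain ⟨d, hd, hdw⟩ := ih (w := w - min w (f a)) (by omega)
    refine ⟨Function.update d a (min w (f a)), fun i => ?_, ?_⟩
    · by_cases h : i = a
      · subst h; simp
      · simpa [h] using hd i
    · rw [Finset.sum_insert ha, Function.update_self, Finset.sum_congr rfl fun i hi =>
        Function.update_of_ne (ne_of_mem_of_not_mem hi ha) _ _, hdw]
      omega

section Correspondence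

variable {r s t : ℕ} {π : Type*} [Fintype π]
  {A1 : Matrix (Fin r) (Fin t) ℤ} {A2 : Matrix (Fin s) (Fin t) ℤ} {G : Matrix (Fin t) π ℤ}

theorem exists_mem_graverBasis_mul_of_mem_nFold {ι : Type*} [Fintype ι] [DecidableEq ι]
    (hG : Set.range G.col = GraverBasis A2) {x : ι × Fin t → ℤ}
    (hx : x ∈ GraverBasis (nFold A1 A2 ι)) :
    ∃ v ∈ GraverBasis (A1 * G), {i | brick x i ≠ 0}.ncard ≤ ∑ j, (v j).natAbs := by
  classical
  obtain ⟨hker, hx0, hmin⟩ := hx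
  rw [nFold_mulVec_eq_zero_iff] at hker
  choose c hcx hc using fun i => exists_conformal_decomposition G hG.ge (hker.2 i)
  have hcol : ∀ j, G.col j ∈ GraverBasis A2 := fun j => hG ▸ Set.mem_range_self j
  have hone : ∀ i, brick x i ≠ 0 → ∃ j, c i j ≠ 0 := by
    intro i hi
    by_contra! h
    refine hi ?_
    rw [← hcx i]
    funext k
    simp [Matrix.mulVec, dotProduct, h]
  -- The products `c i j * G k j * x (i, k)` are all nonnegative.
  have hnn : ∀ i j k, c i j ≠ 0 → 0 ≤ G k j * x (i, k) := fun i j k h => (hc i j h k).1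
  have hpos : ∀ i j, c i j ≠ 0 → ∃ k, 0 < G k j * x (i, k) := by
    intro i j h
    obtain ⟨k, hk⟩ := Function.ne_iff.1 (hcol j).2.1
    refine ⟨k, (hnn i j k h).lt_of_ne' (mul_ne_zero hk fun h0 => hk ?_)⟩
    have := (hc i j h k).2
    simp only [brick, h0] at this
    simpa using this
  have key : ∀ e : ι → π → ℕ, (∀ i j, e i j ≤ c i j) →
      (∀ i k, 0 ≤ G.mulVec (fun j => (e i j : ℤ)) k * x (i, k)) ∧
      ((∀ i k, G.mulVec (fun j => (e i j : ℤ)) k = 0) → ∀ i j, e i j = 0) := by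
    intro e he
    have hterm : ∀ i j k, 0 ≤ G k j * (e i j : ℤ) * x (i, k) := by
      intro i j k
      by_cases h : c i j = 0
      · have : e i j = 0 := by have := he i j; omega
        simp [this]
      · rw [mul_right_comm]
        exact mul_nonneg (hnn i j k h) (by positivity)
    refine ⟨fun i k => ?_, fun h0 i j => ?_⟩
    · simp only [Matrix.mulVec, dotProduct, Finset.sum_mul]
      exact Finset.sum_nonneg fun j _ => hterm i j k
    · by_contra hne
      obtain ⟨k, hk⟩ := hpos i j (by have := he i j; omega)
      have hsum : ∑ j, G k j * (e i j : ℤ) * x (i, k) = 0 := by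
        rw [← Finset.sum_mul]
        exact mul_eq_zero_of_left (h0 i k) _
      have := (Finset.sum_eq_zero_iff_of_nonneg fun j _ => hterm i j k).1 hsum j (Finset.mem_univ j)
      rw [mul_right_comm] at this
      have he0 : (e i j : ℤ) ≠ 0 := by exact_mod_cast hne
      exact (mul_ne_zero hk.ne' he0) this
  have hmulVec : ∀ e : ι → π → ℕ, (A1 * G).mulVec (fun j => ((∑ i, e i j : ℕ) : ℤ)) =
      A1.mulVec (∑ i, G.mulVec fun j => (e i j : ℤ)) := by
    intro e
    rw [← Matrix.mulVec_mulVec]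
    congr 1
    funext k
    simp only [Matrix.mulVec, dotProduct, Finset.sum_apply, Nat.cast_sum, Finset.mul_sum]
    exact Finset.sum_comm
  refine ⟨fun j => ((∑ i, c i j : ℕ) : ℤ), ⟨?_, ?_, fun w hw hw0 hwv => ?_⟩, ?_⟩
  · rw [hmulVec, Finset.sum_congr rfl fun i _ => hcx i]
    exact hker.1
  · obtain ⟨⟨i, k⟩, hik⟩ := Function.ne_iff.1 hx0
    obtain ⟨j, hj⟩ := hone i fun h => hik (congrFun h k)
    refine Function.ne_iff.2 ⟨j, ?_⟩
    have := Finset.single_le_sum (f := fun i => c i j) (fun _ _ => Nat.zero_le _)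
      (Finset.mem_univ i)
    simp only [Pi.zero_apply, ne_eq, Nat.cast_eq_zero]
    omega
  · rw [ConformalLe.iff_forall] at hwv
    choose d hd hdw using fun j => Finset.exists_le_sum_eq Finset.univ (fun i => c i j)
      (w := (w j).toNat) (by have := hwv j; omega)
    have hwd : w = fun j => ((∑ i, d j i : ℕ) : ℤ) := by
      funext j
      have := hwv j
      rw [hdw]
      omega
    let y : ι × Fin t → ℤ := fun q => G.mulVec (fun j => (d j q.1 : ℤ)) q.2
    have hxy : ∀ i k, x (i, k) - y (i, k) = G.mulVec (fun j => ((c i j - d j i : ℕ) : ℤ)) k := by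
      intro i k
      have : (fun j => ((c i j - d j i : ℕ) : ℤ)) = (fun j => (c i j : ℤ)) - fun j => (d j i : ℤ) := by
        funext j
        exact Nat.cast_sub (hd j i)
      rw [this, Matrix.mulVec_sub, hcx]
      rfl
    have hd' := key (fun i j => d j i) fun i j => hd j i
    have hcd := key (fun i j => c i j - d j i) fun i j => Nat.sub_le _ _
    have hyx : y = x := by
      refine hmin y (nFold_mulVec_eq_zero_iff.2 ⟨?_, fun i => ?_⟩) (fun h => hw0 ?_) ?_
      · rw [← hw, hwd, hmulVec]
        rfl
      · change A2.mulVec (G.mulVec fun j => (d j i : ℤ)) = 0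
        rw [Matrix.mulVec_mulVec]
        have : A2 * G = 0 := by
          ext a j
          exact congrFun (hcol j).1 a
        rw [this, Matrix.zero_mulVec]
      · have := hd'.2 fun i k => congrFun h (i, k)
        rw [hwd]
        funext j
        simp [this]
      · rintro ⟨i, k⟩
        have h1 : 0 ≤ y (i, k) * x (i, k) := hd'.1 i k
        have h2 := hcd.1 i k
        rw [← hxy] at h2
        refine ⟨h1, ?_⟩
        by_cases hxk : x (i, k) = 0
        · have : y (i, k) = 0 := by
            refine Finset.sum_eq_zero fun j _ => ?_
            by_cases h : c i j = 0
            · have : d j i = 0 := by have := hd j i; omega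
              simp [this]
            · have := (hc i j h k).2
              simp only [brick, hxk, Matrix.col_apply, abs_zero, abs_nonpos_iff] at this
              simp [this]
          simp [this]
        · rcases lt_or_gt_of_ne hxk with h | h
          · have := nonpos_of_mul_nonneg_left h1 h
            have := nonpos_of_mul_nonneg_left h2 h
            rw [abs_of_neg h, abs_of_nonpos] <;> omega
          · have := nonneg_of_mul_nonneg_left h1 h
            have := nonneg_of_mul_nonneg_left h2 h
            rw [abs_of_pos h, abs_of_nonneg] <;> omega
    have h0 := hcd.2 fun i k => by rw [← hxy, hyx, sub_self]
    rw [hwd]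
    funext j
    congr 1
    refine Finset.sum_congr rfl fun i _ => ?_
    have := h0 i j
    have := hd j i
    omega
  · simp only [Int.natAbs_natCast]
    rw [Finset.sum_comm, Set.ncard_eq_toFinset_card', Set.toFinset_ofPred, Finset.card_filter]
    refine Finset.sum_le_sum fun i _ => ?_
    split_ifs with hi
    · obtain ⟨j, hj⟩ := hone i hi
      exact (Nat.one_le_iff_ne_zero.2 hj).trans
        (Finset.single_le_sum (f := fun j => c i j) (fun _ _ => Nat.zero_le _) (Finset.mem_univ j))
    · exact Nat.zero_le _

theorem exists_mem_nFold_of_mem_graverBasis_mul {p : ℕ} {G : Matrix (Fin t) (Fin p) ℤ}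
    (hG : Set.range G.col = GraverBasis A2) {v : Fin p → ℤ} (hv : v ∈ GraverBasis (A1 * G)) :
    ∃ g ∈ GraverBasis (nFold A1 A2 (Fin (∑ j, (v j).natAbs))), ∀ i, brick g i ≠ 0 := by
  classical
  obtain ⟨hker, hv0, hmin⟩ := hv
  have hcol : ∀ j, G.col j ∈ GraverBasis A2 := fun j => hG ▸ Set.mem_range_self j
  let e := finSigmaFinEquiv (n := fun j => (v j).natAbs)
  clear_value e
  let f : Fin (∑ j, (v j).natAbs) → Fin p := fun i => (e.symm i).1
  have hsum : ∀ h : Fin (∑ j, (v j).natAbs) → ℤ,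
      ∑ i, h i = ∑ j, ∑ l : Fin (v j).natAbs, h (e ⟨j, l⟩) := by
    intro h
    rw [← e.sum_comp, Fintype.sum_sigma]
  have hfe : ∀ j l, f (e ⟨j, l⟩) = j := by simp [f]
  let x : Fin (∑ j, (v j).natAbs) × Fin t → ℤ := fun q => (v (f q.1)).sign * G q.2 (f q.1)
  have hbrick : ∀ i, brick x i ∈ GraverBasis A2 := by
    intro i
    have hvi : v (f i) ≠ 0 := fun h => by
      have := (e.symm i).2.pos
      change 0 < (v (f i)).natAbs at this
      omega
    rcases lt_or_gt_of_ne hvi with h | h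
    · have : brick x i = -G.col (f i) := by
        funext k
        simp [brick, x, Int.sign_eq_neg_one_of_neg h]
      exact this ▸ neg_mem_graverBasis (hcol _)
    · have : brick x i = G.col (f i) := by
        funext k
        simp [brick, x, Int.sign_eq_one_of_pos h]
      exact this ▸ hcol _
  -- `w` records the signed number of bricks selected by `S` among the copies of each column.
  let w (S : Fin (∑ j, (v j).natAbs) → Prop) : Fin p → ℤ := fun j =>
    (v j).sign * (Finset.univ.filter fun l : Fin (v j).natAbs => S (e ⟨j, l⟩)).card
  have hw : ∀ S, (A1 * G).mulVec (w S) =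
      A1.mulVec (∑ i, if S i then brick x i else 0) := by
    intro S
    rw [← Matrix.mulVec_mulVec]
    congr 1
    funext k
    simp only [Finset.sum_apply, hsum, Matrix.mulVec, dotProduct, w]
    refine Finset.sum_congr rfl fun j _ => ?_
    simp only [ite_apply, ← Finset.sum_filter, brick, x, hfe, Pi.zero_apply, Finset.sum_const,
      nsmul_eq_mul]
    ring
  have hwle : ∀ S, ConformalLe (w S) v := by
    intro S
    rw [ConformalLe.iff_forall]
    intro j
    have hcard : (Finset.univ.filter fun l : Fin (v j).natAbs => S (e ⟨j, l⟩)).card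
        ≤ (v j).natAbs := by
      simpa using Finset.card_filter_le Finset.univ fun l : Fin (v j).natAbs => S (e ⟨j, l⟩)
    simp only [w]
    rcases lt_trichotomy (v j) 0 with h | h | h
    · rw [Int.sign_eq_neg_one_of_neg h]; omega
    · simp [h]
    · rw [Int.sign_eq_one_of_pos h]; omega
  have hsign : ∀ j, Fin (v j).natAbs → (v j).sign ≠ 0 := by
    intro j l h
    have := l.pos
    rw [Int.sign_eq_zero_iff_zero] at h
    omega
  have hwtrue : w (fun _ => True) = v := by
    funext j
    simpa [w] using Int.sign_mul_abs (v j)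
  refine ⟨x, ⟨nFold_mulVec_eq_zero_iff.2 ⟨?_, fun i => (hbrick i).1⟩, fun hx0 => hv0 ?_,
    fun y hy hy0 hyx => ?_⟩, fun i => (hbrick i).2.1⟩
  · have := hw fun _ => True
    rw [hwtrue, hker] at this
    simpa using this.symm
  · rw [← hwtrue]
    funext j
    by_contra h
    have : (v j).natAbs ≠ 0 := fun h0 => h (by simp [w, Int.natAbs_eq_zero.1 h0])
    exact (hbrick (e ⟨j, ⟨0, by omega⟩⟩)).2.1 (by rw [hx0]; rfl)
  · rw [nFold_mulVec_eq_zero_iff] at hy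
    have hyi : ∀ i, brick y i ≠ 0 → brick y i = brick x i := fun i hi =>
      (hbrick i).2.2 _ (hy.2 i) hi fun k => hyx (i, k)
    have hwv : w (fun i => brick y i ≠ 0) = v := by
      refine hmin (w fun i => brick y i ≠ 0) ?_ (fun h => hy0 ?_) (hwle fun i => brick y i ≠ 0)
      · refine (hw fun i => brick y i ≠ 0).trans (.trans ?_ hy.1)
        congr 1
        refine Finset.sum_congr rfl fun i _ => ?_
        split_ifs with h
        · exact (hyi i h).symm
        · exact (not_not.1 h).symm
      · funext ⟨i, k⟩
        obtain ⟨⟨j, l⟩, rfl⟩ := e.surjective i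
        have hj := congrFun h j
        simp only [w, Pi.zero_apply, mul_eq_zero, hsign j l, false_or, Nat.cast_eq_zero,
          Finset.card_eq_zero] at hj
        have := Finset.filter_eq_empty_iff.1 hj (Finset.mem_univ l)
        exact congrFun (not_not.1 this) k
    funext ⟨i, k⟩
    obtain ⟨⟨j, l⟩, rfl⟩ := e.surjective i
    have hj := (congrFun hwv j).trans (congrFun hwtrue j).symm
    simp only [w, mul_eq_mul_left_iff, hsign j l, or_false, Nat.cast_inj, Finset.filter_true] at hj
    have hl := Finset.filter_eq_self.1
      (Finset.eq_of_subset_of_card_le (Finset.filter_subset _ _) hj.ge) l (Finset.mem_univ l)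
    exact congrFun (hyi _ hl) k

end Correspondence

/-- If `𝒢(A₂)` is nonempty, `p = |𝒢(A₂)|`, and `G₂` is the `t × p`
matrix whose columns are precisely the elements of `𝒢(A₂)` (each appearing once), then
the Graver complexity `g(A)` equals the maximum `1`-norm `‖v‖₁` of an element `v` of
the Graver basis `𝒢(A₁G₂)` of the `r × p` matrix `A₁G₂` (`0` if `𝒢(A₁G₂)` is empty). -/
theorem graverComplexity_eq_max_one_norm {r s t p : ℕ}
    (A1 : Matrix (Fin r) (Fin t) ℤ) (A2 : Matrix (Fin s) (Fin t) ℤ)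
    (hne : (GraverBasis A2).Nonempty)
    (G2 : Matrix (Fin t) (Fin p) ℤ)
    (hinj : Function.Injective fun j : Fin p => fun i => G2 i j)
    (hrange : Set.range (fun j : Fin p => fun i => G2 i j) = GraverBasis A2) :
    graverComplexity A1 A2 =
      sSup {k : ℕ | ∃ v ∈ GraverBasis (A1 * G2), k = ∑ j, (v j).natAbs} := by
  have hG : Set.range G2.col = GraverBasis A2 := hrange
  have hbdd : BddAbove {k : ℕ | ∃ v ∈ GraverBasis (A1 * G2), k = ∑ j, (v j).natAbs} := by
    refine (((finite_graverBasis (A1 * G2)).image fun v => ∑ j, (v j).natAbs).subset ?_).bddAbove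
    rintro _ ⟨v, hv, rfl⟩
    exact ⟨v, hv, rfl⟩
  have hle : ∀ k ∈ {k : ℕ | ∃ (n : ℕ) (g : Fin n × Fin t → ℤ),
      g ∈ GraverBasis (nFold A1 A2 (Fin n)) ∧ k = {i : Fin n | brick g i ≠ 0}.ncard},
      k ≤ sSup {k : ℕ | ∃ v ∈ GraverBasis (A1 * G2), k = ∑ j, (v j).natAbs} := by
    rintro _ ⟨n, g, hg, rfl⟩
    obtain ⟨v, hv, hle⟩ := exists_mem_graverBasis_mul_of_mem_nFold hG hg
    exact hle.trans (le_csSup hbdd ⟨v, hv, rfl⟩)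
  refine le_antisymm (csSup_le' hle) (csSup_le' ?_)
  rintro _ ⟨v, hv, rfl⟩
  obtain ⟨g, hg, hg0⟩ := exists_mem_nFold_of_mem_graverBasis_mul hG hv
  refine le_csSup ⟨_, hle⟩ ⟨_, g, hg, ?_⟩
  simp [hg0, Set.ncard_univ]
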